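/- Let n ≥ 2 be an integer and λ > 0, μ > 0 reals. Define f(k) = (1/μ)(H(n) − H(n−k)) + 1/(kλ) for k ∈ {1,…,n}, where H(m) = ∑_{l=1}^{m} 1/l (H(0) = 0). Then k = n is a minimizer of f over {1,…,n} (i.e., f(n) ≤ f(k) for all k ∈ {1,…,n}) if and only if λ ≤ μ/(n(n−1)). -/

import Mathlib

/-- The `m`-th harmonic number `H(m) = ∑_{l=1}^m 1/l`, with `H(0) = 0`. -/
noncomputable def harmonicNumber (m : ℕ) : ℝ := ∑ l ∈ Finset.Icc 1 m, (1 : ℝ) / l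

theorem harmonicNumber_zero : harmonicNumber 0 = 0 := by
  simp [harmonicNumber]

theorem harmonicNumber_one : harmonicNumber 1 = 1 := by
  simp [harmonicNumber]

theorem harmonicNumber_le (m : ℕ) : harmonicNumber m ≤ m := by
  have h : ∀ l ∈ Finset.Icc 1 m, (1 : ℝ) / l ≤ 1 := by
    intro l hl
    have hl' : (1 : ℝ) ≤ l := by exact_mod_cast (Finset.mem_Icc.mp hl).1
    exact (div_le_one (by linarith)).mpr hl'
  simpa [harmonicNumber] using Finset.sum_le_sum h

/-- Comparing the expected AoI at `n` and at `k`, with denominators cleared. -/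
theorem aoi_le_iff {n k : ℕ} (hk : 1 ≤ k) (hkn : k ≤ n) {lam mu : ℝ}
    (hlam : 0 < lam) (hmu : 0 < mu) :
    (1 / mu) * (harmonicNumber n - harmonicNumber (n - n)) + 1 / (n * lam) ≤
        (1 / mu) * (harmonicNumber n - harmonicNumber (n - k)) + 1 / (k * lam) ↔
      lam * (n * k) * harmonicNumber (n - k) ≤ mu * ((n : ℝ) - k) := by
  have hk' : (0 : ℝ) < k := by exact_mod_cast hk
  have hn' : (0 : ℝ) < n := by exact_mod_cast hk.trans hkn
  have key : (1 / mu) * (harmonicNumber n - harmonicNumber (n - k)) + 1 / (k * lam) -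
      ((1 / mu) * (harmonicNumber n - harmonicNumber (n - n)) + 1 / (n * lam)) =
      (mu * ((n : ℝ) - k) - lam * (n * k) * harmonicNumber (n - k)) /
        (mu * lam * (n * k)) := by
    rw [Nat.sub_self, harmonicNumber_zero]
    field_simp
    ring
  rw [← sub_nonneg, key, le_div_iff₀ (by positivity), zero_mul, sub_nonneg]

/-- For the expected AoI `f(k) = (1/μ)(H(n) − H(n−k)) + 1/(kλ)` with `n ≥ 2`, waiting for all
`n` responses (`k = n`) is optimal over `{1,…,n}` if and only if `λ ≤ μ/(n(n−1))`. -/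
theorem all_responses_optimal_iff (n : ℕ) (hn : 2 ≤ n) (lam mu : ℝ)
    (hlam : 0 < lam) (hmu : 0 < mu) :
    let f : ℕ → ℝ := fun k =>
      (1 / mu) * (harmonicNumber n - harmonicNumber (n - k)) + 1 / (k * lam)
    (∀ k : ℕ, 1 ≤ k → k ≤ n → f n ≤ f k) ↔ lam ≤ mu / ((n : ℝ) * ((n : ℝ) - 1)) := by
  intro f
  have hn' : (2 : ℝ) ≤ n := by exact_mod_cast hn
  have hpos : 0 < (n : ℝ) * ((n : ℝ) - 1) := mul_pos (by linarith) (by linarith)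
  rw [le_div_iff₀ hpos]
  constructor
  · intro h
    have h' := (aoi_le_iff (by omega) (by omega) hlam hmu).mp
      (h (n - 1) (by omega) (by omega))
    rw [Nat.sub_sub_self (by omega), harmonicNumber_one, Nat.cast_sub (by omega)] at h'
    simpa using h'
  · intro h k hk hkn
    refine (aoi_le_iff hk hkn hlam hmu).mpr ?_
    rcases hkn.eq_or_lt with rfl | hlt
    · simp [harmonicNumber_zero]
    have hk' : (k : ℝ) ≤ n - 1 := by
      have : (k : ℝ) + 1 ≤ n := by exact_mod_cast hlt
      linarith
    have hH := harmonicNumber_le (n - k)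
    rw [Nat.cast_sub hkn] at hH
    calc lam * (n * k) * harmonicNumber (n - k)
        ≤ lam * (n * k) * ((n : ℝ) - k) := by gcongr
      _ ≤ lam * (n * ((n : ℝ) - 1)) * ((n : ℝ) - k) := by
          have : (0 : ℝ) ≤ (n : ℝ) - k := by linarith
          gcongr
      _ ≤ mu * ((n : ℝ) - k) := mul_le_mul_of_nonneg_right h (by linarith)
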